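/- arXiv:0908.2128 — 2 statements merged into one kernel-verified Lean document; each statement's English description precedes it below -/
import Mathlib

section
/- Let σ ≥ 0 and let D be a real diagonal d×d matrix with D ≥ −σ𝟙 (every diagonal entry at least −σ). Then there exists a real symmetric d×d matrix P with P_{i,i} = 0 for all i such that (𝟙 − wwᵀ)(D + P)(𝟙 − wwᵀ) is positive semidefinite, where w = (1,1,…,1)ᵀ/√d. -/
open Matrix

/-- The unit vector `w = (1,…,1)ᵀ/√d ∈ ℝ^d`. -/
noncomputable def wVec (d : ℕ) : Fin d → ℝ := fun _ => (Real.sqrt d)⁻¹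

/-- The orthogonal projector `wwᵀ` onto the span of the all-ones vector. -/
noncomputable def wProj (d : ℕ) : Matrix (Fin d) (Fin d) ℝ :=
  Matrix.vecMulVec (wVec d) (wVec d)

/-- If `σ ≥ 0` and `D` is a real diagonal `d×d` matrix with every diagonal entry at least
`−σ`, then there exists a real symmetric matrix `P` with zero diagonal such that
`(𝟙 − wwᵀ)(D + P)(𝟙 − wwᵀ)` is positive semidefinite, where `w = (1,…,1)ᵀ/√d`. -/
theorem stmt10 (d : ℕ) (σ : ℝ) (hσ : 0 ≤ σ)
    (D : Matrix (Fin d) (Fin d) ℝ) (hdiag : D.IsDiag)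
    (hD : ∀ i, -σ ≤ D i i) :
    ∃ P : Matrix (Fin d) (Fin d) ℝ, P.IsSymm ∧ (∀ i, P i i = 0) ∧
      ((1 - wProj d) * (D + P) * (1 - wProj d)).PosSemidef := by
  have hent : ∀ i j, wProj d i j = (d : ℝ)⁻¹ := by
    intro i j
    simp only [wProj, wVec, Matrix.vecMulVec_apply]
    rw [← mul_inv, Real.mul_self_sqrt (Nat.cast_nonneg d)]
  have hd0 : ∀ _ : Fin d, (d : ℝ) ≠ 0 := by
    intro i
    have := i.pos
    positivity
  have hW : wProj d * wProj d = wProj d := by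
    ext i j
    have := hd0 i
    simp only [Matrix.mul_apply, hent, Finset.sum_const, Finset.card_univ, Fintype.card_fin,
      nsmul_eq_mul]
    field_simp
  have hWs : (wProj d)ᵀ = wProj d := by
    ext i j
    simp only [Matrix.transpose_apply, hent]
  have hWH : (1 - wProj d)ᴴ = 1 - wProj d := by
    rw [Matrix.conjTranspose_eq_transpose_of_trivial, Matrix.transpose_sub,
      Matrix.transpose_one, hWs]
  refine ⟨σ • (1 : Matrix (Fin d) (Fin d) ℝ) - (σ * d) • wProj d, ?_, ?_, ?_⟩
  · unfold Matrix.IsSymm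
    rw [Matrix.transpose_sub, Matrix.transpose_smul, Matrix.transpose_smul, hWs,
      Matrix.transpose_one]
  · intro i
    have := hd0 i
    simp only [Matrix.sub_apply, Matrix.smul_apply, hent, Matrix.one_apply_eq, smul_eq_mul]
    field_simp
    simp
  · have h0 : (1 - wProj d) * wProj d = 0 := by
      rw [sub_mul, hW, one_mul, sub_self]
    have key : (1 - wProj d) * (D + (σ • (1 : Matrix (Fin d) (Fin d) ℝ) - (σ * d) • wProj d))
        * (1 - wProj d) = (1 - wProj d)ᴴ * (D + σ • (1 : Matrix (Fin d) (Fin d) ℝ))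
        * (1 - wProj d) := by
      rw [hWH, ← add_sub_assoc, mul_sub (1 - wProj d) (D + σ • 1), Matrix.mul_smul, h0, smul_zero, sub_zero]
    rw [key]
    apply Matrix.PosSemidef.conjTranspose_mul_mul_same
    have hdg : D + σ • (1 : Matrix (Fin d) (Fin d) ℝ)
        = Matrix.diagonal (fun i => D i i + σ) := by
      ext i j
      by_cases h : i = j
      · subst h; simp
      · simp [h, hdiag h]
    rw [hdg]
    apply Matrix.PosSemidef.diagonal
    intro i
    have := hD i
    simp only [Pi.zero_apply]
    linarith
end

section
/- Let d ≥ 1 and let L be a d²×d² complex matrix (indexed by pairs (i,j), i,j ∈ {1,…,d}) such that L^Γ is Hermitian, ⟨ω| L = 0, and every eigenvalue of (𝟙 − |ω⟩⟨ω|) L^Γ (𝟙 − |ω⟩⟨ω|) is at least −ε for some ε ≥ 0. Then there exists a matrix L' satisfying (i) L'^Γ Hermitian, (ii) ⟨ω| L' = 0, and (iii) (𝟙 − |ω⟩⟨ω|) L'^Γ (𝟙 − |ω⟩⟨ω|) positive semidefinite, with ‖L' − L‖_F ≤ ε · d · ‖𝟙 − |ω⟩⟨ω|‖_F. A valid choice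 is L' = L + ε(d·|ω⟩⟨ω| − d·𝟙). -/
open Matrix
open scoped ComplexOrder

/-- The involution `Γ` on `d²×d²` matrices: `(A^Γ)_{(i,k),(j,l)} = A_{(i,j),(k,l)}`. -/
def Gamma {d : ℕ} (A : Matrix (Fin d × Fin d) (Fin d × Fin d) ℂ) :
    Matrix (Fin d × Fin d) (Fin d × Fin d) ℂ :=
  Matrix.of fun p q => A (p.1, q.1) (p.2, q.2)

/-- The maximally entangled vector `|ω⟩ ∈ ℂ^{d²}`, with entries `ω_{(i,j)} = δ_{ij}/√d`. -/
noncomputable def omegaVec (d : ℕ) : Fin d × Fin d → ℂ :=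
  fun p => if p.1 = p.2 then ((Real.sqrt d)⁻¹ : ℝ) else 0

/-- The rank-one projector `|ω⟩⟨ω|`. -/
noncomputable def omegaProj (d : ℕ) : Matrix (Fin d × Fin d) (Fin d × Fin d) ℂ :=
  Matrix.vecMulVec (omegaVec d) (star (omegaVec d))

/-- Frobenius norm of a complex matrix. -/
noncomputable def frob {m k : Type*} [Fintype m] [Fintype k] (X : Matrix m k ℂ) : ℝ :=
  Real.sqrt (∑ i, ∑ j, ‖X i j‖ ^ 2)

theorem omegaVec_norm (d : ℕ) (hd : 1 ≤ d) : star (omegaVec d) ⬝ᵥ omegaVec d = 1 := by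
  have h0 : (0 : ℝ) ≤ d := by positivity
  have h1 : (d : ℂ) ≠ 0 := by
    have : d ≠ 0 := by omega
    exact_mod_cast this
  have h2 : (((Real.sqrt d)⁻¹ : ℝ) : ℂ) * (((Real.sqrt d)⁻¹ : ℝ) : ℂ) = (d : ℂ)⁻¹ := by
    rw [← Complex.ofReal_mul, ← mul_inv, Real.mul_self_sqrt h0]
    push_cast
    rfl
  have h3 : ∀ p : Fin d × Fin d, star (omegaVec d) p * omegaVec d p
      = if p.1 = p.2 then (d : ℂ)⁻¹ else 0 := by
    intro p
    simp only [Pi.star_apply, omegaVec]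
    split_ifs
    · rw [← h2]; simp
    · simp
  simp only [dotProduct, h3, Fintype.sum_prod_type]
  simp [h1]

theorem omegaProj_smul_apply (d : ℕ) (hd : 1 ≤ d) (p q : Fin d × Fin d) :
    (d : ℂ) * omegaProj d p q = if p.1 = p.2 ∧ q.1 = q.2 then 1 else 0 := by
  have h0 : (0 : ℝ) ≤ d := by positivity
  have h1 : (d : ℂ) ≠ 0 := by
    have : d ≠ 0 := by omega
    exact_mod_cast this
  have h2 : (((Real.sqrt d)⁻¹ : ℝ) : ℂ) * (((Real.sqrt d)⁻¹ : ℝ) : ℂ) = (d : ℂ)⁻¹ := by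
    rw [← Complex.ofReal_mul, ← mul_inv, Real.mul_self_sqrt h0]
    push_cast
    rfl
  simp only [omegaProj, vecMulVec_apply, Pi.star_apply, omegaVec]
  by_cases hp : p.1 = p.2 <;> by_cases hq : q.1 = q.2
  · have h4 : star (((Real.sqrt d)⁻¹ : ℝ) : ℂ) = (((Real.sqrt d)⁻¹ : ℝ) : ℂ) :=
      Complex.conj_ofReal _
    rw [if_pos hp, if_pos hq, if_pos ⟨hp, hq⟩, h4, h2, mul_inv_cancel₀ h1]
  · simp [hp, hq]
  · simp [hp, hq]
  · simp [hp, hq]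

theorem omegaProj_sq (d : ℕ) (hd : 1 ≤ d) : omegaProj d * omegaProj d = omegaProj d := by
  rw [omegaProj, vecMulVec_mul_vecMulVec, omegaVec_norm d hd]
  simp

theorem omegaProj_herm (d : ℕ) : (omegaProj d).IsHermitian := by
  rw [omegaProj, Matrix.IsHermitian, conjTranspose_vecMulVec, star_star]

theorem Gamma_choice (d : ℕ) (hd : 1 ≤ d)
    (L : Matrix (Fin d × Fin d) (Fin d × Fin d) ℂ) (ε : ℝ) :
    Gamma (L + (ε : ℂ) • ((d : ℂ) • omegaProj d - (d : ℂ) • 1))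
      = Gamma L + (ε : ℂ) • (1 - ((d : ℂ) * d) • omegaProj d) := by
  ext p q
  simp only [Gamma, of_apply, Matrix.add_apply, Matrix.smul_apply, Matrix.sub_apply, smul_eq_mul,
    mul_assoc, omegaProj_smul_apply d hd, one_apply, Prod.ext_iff]

theorem posSemidef_add_of_spectrum {n : Type*} [Fintype n] [DecidableEq n]
    (M : Matrix n n ℂ) (hM : M.IsHermitian) (ε : ℝ)
    (h : ∀ μ ∈ spectrum ℂ M, -ε ≤ μ.re) : (M + (ε : ℂ) • 1).PosSemidef := by
  have hA : (M + (ε : ℂ) • (1 : Matrix n n ℂ)).IsHermitian := by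
    refine hM.add ?_
    rw [Matrix.IsHermitian, conjTranspose_smul, conjTranspose_one]
    congr 1
    exact Complex.conj_ofReal _
  rw [hA.posSemidef_iff_eigenvalues_nonneg]
  intro i
  have h1 : ((hA.eigenvalues i : ℝ) : ℂ) ∈ spectrum ℂ (M + (ε : ℂ) • (1 : Matrix n n ℂ)) := by
    rw [hA.spectrum_eq_image_range]
    exact ⟨_, ⟨i, rfl⟩, rfl⟩
  have h2 : ((hA.eigenvalues i : ℝ) : ℂ) - ε ∈ spectrum ℂ M := by
    generalize ((hA.eigenvalues i : ℝ) : ℂ) = x at h1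
    rw [← Algebra.algebraMap_eq_smul_one] at h1
    rw [spectrum.mem_iff] at h1 ⊢
    rwa [map_sub, sub_sub, add_comm (algebraMap ℂ (Matrix n n ℂ) (ε : ℂ)) M]
  have h3 := h _ h2
  simp at h3
  simpa using h3

theorem frob_smul {m k : Type*} [Fintype m] [Fintype k] (c : ℂ) (X : Matrix m k ℂ) :
    frob (c • X) = ‖c‖ * frob X := by
  simp only [frob, Matrix.smul_apply, norm_smul, mul_pow, ← Finset.mul_sum]
  rw [Real.sqrt_mul (by positivity), Real.sqrt_sq (norm_nonneg _)]

/-- If `L^Γ` is Hermitian, `⟨ω|L = 0`, and every eigenvalue of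
`(𝟙 − |ω⟩⟨ω|) L^Γ (𝟙 − |ω⟩⟨ω|)` is at least `−ε` (with `ε ≥ 0`), then there exists a
Lindblad generator `L'` (i.e. `L'^Γ` Hermitian, `⟨ω|L' = 0`, and
`(𝟙 − |ω⟩⟨ω|) L'^Γ (𝟙 − |ω⟩⟨ω|)` positive semidefinite) with
`‖L' − L‖_F ≤ ε·d·‖𝟙 − |ω⟩⟨ω|‖_F`; a valid choice is `L' = L + ε(d·|ω⟩⟨ω| − d·𝟙)`. -/
theorem stmt14 (d : ℕ) (hd : 1 ≤ d)
    (L : Matrix (Fin d × Fin d) (Fin d × Fin d) ℂ) (ε : ℝ) (hε : 0 ≤ ε)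
    (hherm : (Gamma L).IsHermitian)
    (hnorm : Matrix.vecMul (star (omegaVec d)) L = 0)
    (heig : ∀ μ ∈ spectrum ℂ ((1 - omegaProj d) * Gamma L * (1 - omegaProj d)),
      -ε ≤ μ.re) :
    ∃ L' : Matrix (Fin d × Fin d) (Fin d × Fin d) ℂ,
      (Gamma L').IsHermitian ∧
      Matrix.vecMul (star (omegaVec d)) L' = 0 ∧
      ((1 - omegaProj d) * Gamma L' * (1 - omegaProj d)).PosSemidef ∧
      frob (L' - L) ≤ ε * d * frob (1 - omegaProj d) ∧
      L' = L + (ε : ℂ) • ((d : ℂ) • omegaProj d - (d : ℂ) • 1) := by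
  refine ⟨_, ?_, ?_, ?_, ?_, rfl⟩
  · rw [Gamma_choice d hd]
    refine hherm.add ?_
    have hP := omegaProj_herm d
    rw [Matrix.IsHermitian] at hP ⊢
    simp [conjTranspose_smul, hP]
  · rw [vecMul_add, hnorm, vecMul_smul, vecMul_sub, vecMul_smul, vecMul_smul, vecMul_one]
    rw [omegaProj, vecMul_vecMulVec, omegaVec_norm d hd]
    simp
  · rw [Gamma_choice d hd]
    have hPP := omegaProj_sq d hd
    have hQ : (1 - omegaProj d).IsHermitian := isHermitian_one.sub (omegaProj_herm d)
    have hQP : (1 - omegaProj d) * omegaProj d = 0 := by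
      rw [sub_mul, one_mul, hPP, sub_self]
    have hQQ : (1 - omegaProj d) * (1 - omegaProj d) = 1 - omegaProj d := by
      rw [mul_sub, hQP, mul_one, sub_zero]
    generalize 1 - omegaProj d = Q at *
    have hM : (Q * Gamma L * Q).IsHermitian := by
      have := isHermitian_conjTranspose_mul_mul Q hherm
      rwa [hQ.eq] at this
    have h1 := (posSemidef_add_of_spectrum _ hM ε heig).conjTranspose_mul_mul_same Q
    rw [hQ.eq] at h1
    convert h1 using 1
    have e1 : Q * (Q * Gamma L * Q) * Q = Q * Gamma L * Q := by
      calc Q * (Q * Gamma L * Q) * Q = (Q * Q) * Gamma L * (Q * Q) := by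
            simp only [mul_assoc]
        _ = _ := by rw [hQQ]
    simp only [mul_add, add_mul, mul_sub, sub_mul, Matrix.mul_smul, Matrix.smul_mul, mul_one,
      hQP, hQQ, e1, zero_mul, smul_zero, sub_zero]
  · have e : L + (ε : ℂ) • ((d : ℂ) • omegaProj d - (d : ℂ) • 1) - L
        = (-((ε : ℂ) * d)) • (1 - omegaProj d) := by
      module
    rw [e, frob_smul]
    simp [abs_of_nonneg hε]
end
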